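/- Let R be a Noetherian integral domain of prime characteristic p which is F-finite (R is a finitely generated module over its subring R^p = {r^p : r ∈ R} of p-th powers) and Frobenius split. Suppose there is a nonzero element c ∈ R such that (1) the localization R[c^{-1}] is strongly F-regular, and (2) there exist an integer e ≥ 1 and a p^{-e}-linear map ψ on R with ψ(c) = 1. Then R is strongly F-regular. -/

import Mathlib

/-- A `p^{-e}`-linear map on a commutative ring `R` of characteristic `p` (with `q = p^e`):
an additive map `ψ : R → R` satisfying `ψ (a ^ q * b) = a * ψ b` for all `a b`. -/
def IsPeLinear {R : Type*} [CommRing R] (q : ℕ) (ψ : R → R) : Prop :=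
  (∀ a b : R, ψ (a + b) = ψ a + ψ b) ∧ (∀ a b : R, ψ (a ^ q * b) = a * ψ b)

/-- `R` is strongly `F`-regular: for every nonzero `c` there exist `e ≥ 1` and a
`p^{-e}`-linear map `ψ` with `ψ c = 1`. -/
def StronglyFRegular (R : Type*) [CommRing R] (p : ℕ) : Prop :=
  ∀ c : R, c ≠ 0 → ∃ e : ℕ, 1 ≤ e ∧ ∃ ψ : R → R, IsPeLinear (p ^ e) ψ ∧ ψ c = 1

/-- Precomposing with multiplication by a ring element preserves `p^{-e}`-linearity. -/
theorem IsPeLinear.comp_mul_left {R : Type*} [CommRing R] {q : ℕ} {ψ : R → R}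
    (hψ : IsPeLinear q ψ) (r : R) : IsPeLinear q (fun x => ψ (r * x)) :=
  ⟨fun a b => by simp only [mul_add, hψ.1],
    fun a b => by simp only [mul_left_comm r, hψ.2]⟩

theorem IsPeLinear.comp {R : Type*} [CommRing R] {q q' : ℕ} {ψ ψ' : R → R}
    (hψ' : IsPeLinear q' ψ') (hψ : IsPeLinear q ψ) : IsPeLinear (q' * q) (ψ' ∘ ψ) :=
  ⟨fun a b => by simp only [Function.comp_apply, hψ.1, hψ'.1],
    fun a b => by simp only [Function.comp_apply, pow_mul, hψ.2, hψ'.2]⟩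

/-- If a `p^{-e}`-linear map sends `c` to `1`, then some `p^{-e'}`-linear map sends `c ^ n`
to `1`, for every `n`. -/
theorem exists_isPeLinear_pow_eq_one {R : Type*} [CommRing R] {p : ℕ} (hp : 1 ≤ p) {c : R}
    (h : ∃ e : ℕ, 1 ≤ e ∧ ∃ ψ : R → R, IsPeLinear (p ^ e) ψ ∧ ψ c = 1) (n : ℕ) :
    ∃ e : ℕ, 1 ≤ e ∧ ∃ ψ : R → R, IsPeLinear (p ^ e) ψ ∧ ψ (c ^ n) = 1 := by
  obtain ⟨e, he, ψ, hψ, hc⟩ := h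
  induction n with
  | zero => exact ⟨e, he, _, hψ.comp_mul_left c, by simpa using hc⟩
  | succ n ih =>
    obtain ⟨e', -, ψ', hψ', hone⟩ := ih
    have hle : n ≤ n * p ^ e := Nat.le_mul_of_pos_right n (Nat.pow_pos hp)
    refine ⟨e' + e, by omega, _, pow_add p e' e ▸ hψ'.comp
      (hψ.comp_mul_left (c ^ (n * p ^ e - n))), ?_⟩
    have key : c ^ (n * p ^ e - n) * c ^ (n + 1) = (c ^ n) ^ p ^ e * c := by
      rw [← pow_add, ← pow_mul, ← pow_succ]
      congr 1
      omega
    simp only [Function.comp_apply, key, hψ.2, hc, mul_one, hone]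

/-- An `F`-finite ring is additively generated by the elements `a ^ p ^ e * g`, with `g` ranging
over a finite set. -/
theorem exists_finset_pow_mul_generate {R : Type*} [CommRing R] (p : ℕ) [ExpChar R p]
    (hF : Module.Finite (RingHom.range (frobenius R p)) R) (e : ℕ) :
    ∃ s : Finset R, ∀ A : AddSubgroup R, (∀ a, ∀ g ∈ s, a ^ p ^ e * g ∈ A) → A = ⊤ := by
  classical
  induction e with
  | zero =>
    exact ⟨{1}, fun A hA => (AddSubgroup.eq_top_iff' A).2 fun x => by simpa using hA x⟩
  | succ e ih =>
    obtain ⟨t, ht⟩ := ih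
    obtain ⟨s, hs⟩ := hF.fg_top
    refine ⟨Finset.image₂ (fun b g => b ^ p * g) t s, fun A hA => ?_⟩
    have hsub : ∀ g ∈ s, ∀ a : R, a ^ p * g ∈ A := by
      intro g hg a
      have htop := ht (A.comap ((AddMonoidHom.mulRight g).comp (frobenius R p).toAddMonoidHom))
        fun a b hb => by
          have := hA a _ (Finset.mem_image₂_of_mem hb hg)
          simpa [frobenius_def, mul_pow, ← pow_mul, ← pow_succ, mul_assoc] using this
      have ha := htop ▸ AddSubgroup.mem_top a
      simpa [frobenius_def] using ha
    refine (AddSubgroup.eq_top_iff' A).2 fun x => ?_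
    have hx : x ∈ Submodule.span (RingHom.range (frobenius R p)) (s : Set R) :=
      hs ▸ Submodule.mem_top
    induction hx using Submodule.closure_induction with
    | zero => exact A.zero_mem
    | add x y _ _ hx hy => exact A.add_mem hx hy
    | smul_mem r g hg =>
      obtain ⟨_, a, rfl⟩ := r
      exact hsub g hg a

/-- Over an `F`-finite domain, a `p^{-e}`-linear map on a localization restricts to the base ring
after multiplication by some element of the localized submonoid. -/
theorem IsPeLinear.exists_restrict {R S : Type*} [CommRing R] [CommRing S] [Algebra R S]
    {p : ℕ} [ExpChar R p] (hF : Module.Finite (RingHom.range (frobenius R p)) R)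
    (M : Submonoid R) [IsLocalization M S] (hM : M ≤ nonZeroDivisors R) {e : ℕ} {ψ : S → S}
    (hψ : IsPeLinear (p ^ e) ψ) :
    ∃ b ∈ M, ∃ θ : R → R, IsPeLinear (p ^ e) θ ∧
      ∀ x, algebraMap R S (θ x) = algebraMap R S b * ψ (algebraMap R S x) := by
  classical
  obtain ⟨s, hs⟩ := exists_finset_pow_mul_generate p hF e
  obtain ⟨b, hb⟩ := IsLocalization.exist_integer_multiples_of_finset M
    (s.image fun g => ψ (algebraMap R S g))
  let f : R →+ S := (AddMonoidHom.mulLeft (algebraMap R S b)).comp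
    ((AddMonoidHom.mk' ψ hψ.1).comp (algebraMap R S).toAddMonoidHom)
  have htop := hs ((algebraMap R S).toAddMonoidHom.range.comap f) fun a g hg => by
    obtain ⟨r, hr⟩ := hb _ (Finset.mem_image_of_mem _ hg)
    refine ⟨a * r, ?_⟩
    simp only [Algebra.smul_def] at hr
    simp [f, hψ.2, hr, mul_left_comm]
  have hmem : ∀ x, ∃ r, algebraMap R S r = algebraMap R S b * ψ (algebraMap R S x) :=
    fun x => (AddSubgroup.eq_top_iff' _).1 htop x
  choose θ hθ using hmem
  have hinj := IsLocalization.injective S hM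
  refine ⟨b, b.2, θ, ⟨fun x y => hinj ?_, fun x y => hinj ?_⟩, hθ⟩
  · simp only [map_add, hθ, hψ.1, mul_add]
  · simp only [map_mul, map_pow, hθ, hψ.2, mul_left_comm]

/-- Hochster–Huneke test element criterion: if `R` is a Noetherian `F`-finite Frobenius-split
domain of characteristic `p`, and `c ≠ 0` is such that `R[c⁻¹]` is strongly `F`-regular and
some `p^{-e}`-linear map sends `c` to `1`, then `R` is strongly `F`-regular. -/
theorem stronglyFRegular_of_test_element
    (R : Type*) [CommRing R] [IsDomain R] [IsNoetherianRing R]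
    (p : ℕ) [Fact p.Prime] [CharP R p]
    (hFfinite : Module.Finite (RingHom.range (frobenius R p)) R)
    (hsplit : ∃ φ : R → R, IsPeLinear (p ^ 1) φ ∧ φ 1 = 1)
    (c : R) (hc : c ≠ 0)
    (hloc : StronglyFRegular (Localization.Away c) p)
    (htest : ∃ e : ℕ, 1 ≤ e ∧ ∃ ψ : R → R, IsPeLinear (p ^ e) ψ ∧ ψ c = 1) :
    StronglyFRegular R p := by
  intro d hd
  have hp : p.Prime := Fact.out
  have : ExpChar R p := ExpChar.prime hp
  have hM := powers_le_nonZeroDivisors_of_noZeroDivisors hc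
  have hinj := IsLocalization.injective (Localization.Away c) hM
  obtain ⟨e, he, ψ, hψ, hψd⟩ := hloc (algebraMap R _ d)
    ((map_ne_zero_iff _ hinj).2 hd)
  obtain ⟨_, ⟨n, rfl⟩, θ, hθ, hθψ⟩ := hψ.exists_restrict hFfinite (Submonoid.powers c) hM
  have hθd : θ d = c ^ n := hinj (by rw [hθψ, hψd, mul_one])
  obtain ⟨e', -, ψ', hψ', hψ'c⟩ := exists_isPeLinear_pow_eq_one hp.one_le htest n
  exact ⟨e' + e, by omega, _, pow_add p e' e ▸ hψ'.comp hθ, by simp [hθd, hψ'c]⟩
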